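/- arXiv:1706.01873 — 2 statements merged into one kernel-verified Lean document; each statement's English description precedes it below -/
import Mathlib

section
/- Let x ∈ X, 0 < r < (1/8) diam X, and A ⊂ B(x,r) with x ∈ I_A (the measure-theoretic interior of A). Then there exists s_r ∈ (0,r] such that μ(B(x,s_r))/(C₂ s_r) ≤ cap₁(A, B(x,2r)), where C₂ is a constant depending only on C_d and C_P. -/
open MeasureTheory Metric Filter Set
open scoped ENNReal NNReal Topology

noncomputable section

namespace MetricBV

variable {X : Type*} [MetricSpace X] [MeasurableSpace X]

/-- A rectifiable curve, encoded as a Lipschitz map on the interval `[0,1]`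
(every rectifiable curve admits such a reparametrization). -/
structure Curve (X : Type*) [MetricSpace X] where
  toFun : ℝ → X
  lipschitz : ∃ K : ℝ≥0, LipschitzOnWith K toFun (Set.Icc 0 1)

/-- The metric speed of a curve at a point. -/
def speed (γ : ℝ → X) (t : ℝ) : ℝ≥0∞ :=
  Filter.limsup (fun h : ℝ => ENNReal.ofReal (dist (γ (t + h)) (γ t) / |h|)) (𝓝[≠] (0 : ℝ))

/-- The curve integral `∫_γ g ds`. -/
def curveIntegral (g : X → ℝ≥0∞) (γ : Curve X) : ℝ≥0∞ :=
  ∫⁻ t in Set.Icc (0 : ℝ) 1, g (γ.toFun t) * speed γ.toFun t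

/-- A curve lies in a set `Ω`. -/
def Curve.In (γ : Curve X) (Ω : Set X) : Prop :=
  ∀ t ∈ Set.Icc (0 : ℝ) 1, γ.toFun t ∈ Ω

/-- The 1-modulus of a family of curves. -/
def Mod1 (μ : Measure X) (Γ : Set (Curve X)) : ℝ≥0∞ :=
  ⨅ (ρ : X → ℝ≥0∞) (_ : Measurable ρ) (_ : ∀ γ ∈ Γ, 1 ≤ curveIntegral ρ γ),
    ∫⁻ x, ρ x ∂μ

/-- `g` is an upper gradient of `u` in `Ω`: the upper gradient inequality holds
along every curve contained in `Ω`. -/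
def IsUpperGradientOn (g : X → ℝ≥0∞) (u : X → ℝ) (Ω : Set X) : Prop :=
  ∀ γ : Curve X, γ.In Ω →
    ENNReal.ofReal |u (γ.toFun 1) - u (γ.toFun 0)| ≤ curveIntegral g γ

/-- `g` is a 1-weak upper gradient of `u` in `Ω`: the upper gradient inequality holds
along every curve in `Ω` outside a family of zero 1-modulus. -/
def IsWeakUpperGradientOn (μ : Measure X) (g : X → ℝ≥0∞) (u : X → ℝ) (Ω : Set X) : Prop :=
  ∃ Γ : Set (Curve X), Mod1 μ Γ = 0 ∧
    ∀ γ : Curve X, γ ∉ Γ → γ.In Ω →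
      ENNReal.ofReal |u (γ.toFun 1) - u (γ.toFun 0)| ≤ curveIntegral g γ

/-- Membership in the Newtonian space `N^{1,1}(X)`. -/
def MemN11 (μ : Measure X) (u : X → ℝ) : Prop :=
  Integrable u μ ∧ ∃ g : X → ℝ≥0∞, Measurable g ∧
    IsWeakUpperGradientOn μ g u Set.univ ∧ ∫⁻ x, g x ∂μ < ⊤

/-- The 1-capacity `cap₁(A) = inf ‖u‖_{N^{1,1}(X)}` over `u ∈ N^{1,1}(X)` with `u ≥ 1` on `A`. -/
def cap1 (μ : Measure X) (A : Set X) : ℝ≥0∞ :=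
  ⨅ (u : X → ℝ) (_ : MemN11 μ u) (_ : ∀ x ∈ A, 1 ≤ u x)
    (g : X → ℝ≥0∞) (_ : Measurable g) (_ : IsWeakUpperGradientOn μ g u Set.univ),
    (∫⁻ x, ENNReal.ofReal |u x| ∂μ + ∫⁻ x, g x ∂μ)

/-- The variational 1-capacity `cap₁(A,Ω) = inf ∫ g_u dμ` over `u ∈ N^{1,1}(X)` with
`u ≥ 1` on `A` and `u = 0` on `X ∖ Ω`. -/
def vcap1 (μ : Measure X) (A Ω : Set X) : ℝ≥0∞ :=
  ⨅ (u : X → ℝ) (_ : MemN11 μ u) (_ : ∀ x ∈ A, 1 ≤ u x) (_ : ∀ x ∈ Ωᶜ, u x = 0)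
    (g : X → ℝ≥0∞) (_ : Measurable g) (_ : IsWeakUpperGradientOn μ g u Set.univ),
    ∫⁻ x, g x ∂μ

/-- Locally Lipschitz in `Ω`: Lipschitz on every compact subset of `Ω`. -/
def LocLipschitzOn (u : X → ℝ) (Ω : Set X) : Prop :=
  ∀ K : Set X, IsCompact K → K ⊆ Ω → ∃ L : ℝ≥0, LipschitzOnWith L u K

/-- Convergence `v i → u` in `L¹_loc(Ω)`. -/
def TendstoL1Loc (μ : Measure X) (v : ℕ → X → ℝ) (u : X → ℝ) (Ω : Set X) : Prop :=
  ∀ K : Set X, IsCompact K → K ⊆ Ω →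
    Filter.Tendsto (fun i => ∫⁻ x in K, ENNReal.ofReal |v i x - u x| ∂μ)
      Filter.atTop (𝓝 0)

/-- The total variation `‖Du‖(Ω)` of `u` in an open set `Ω`: the infimum of
`liminf ∫_Ω g_i dμ` over sequences of locally Lipschitz functions `v i → u` in `L¹_loc(Ω)`
with `g i` a 1-weak upper gradient of `v i` in `Ω`. -/
def tv (μ : Measure X) (u : X → ℝ) (Ω : Set X) : ℝ≥0∞ :=
  ⨅ (v : ℕ → X → ℝ) (_ : ∀ i, LocLipschitzOn (v i) Ω) (_ : TendstoL1Loc μ v u Ω)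
    (g : ℕ → X → ℝ≥0∞) (_ : ∀ i, Measurable (g i))
    (_ : ∀ i, IsWeakUpperGradientOn μ (g i) (v i) Ω),
    Filter.liminf (fun i => ∫⁻ x in Ω, g i x ∂μ) Filter.atTop

/-- The total variation `‖Du‖(A)` for an arbitrary set `A`. -/
def tvs (μ : Measure X) (u : X → ℝ) (A : Set X) : ℝ≥0∞ :=
  ⨅ (U : Set X) (_ : IsOpen U) (_ : A ⊆ U), tv μ u U

/-- The characteristic function of a set, as a real-valued function. -/
def chi (E : Set X) : X → ℝ := Set.indicator E fun _ => (1 : ℝ)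

/-- The perimeter `P(E,Ω) = ‖Dχ_E‖(Ω)` of `E` in an open set `Ω`. -/
def perim (μ : Measure X) (E : Set X) (Ω : Set X) : ℝ≥0∞ := tv μ (chi E) Ω

/-- `u ∈ BV(Ω)`: `u ∈ L¹(Ω)` and `‖Du‖(Ω) < ∞`. -/
def MemBV (μ : Measure X) (u : X → ℝ) (Ω : Set X) : Prop :=
  IntegrableOn u Ω μ ∧ tv μ u Ω < ⊤

/-- `u ∈ BV_loc(Ω)`. -/
def MemBVloc (μ : Measure X) (u : X → ℝ) (Ω : Set X) : Prop :=
  ∀ K : Set X, IsCompact K → K ⊆ Ω → ∃ U : Set X, IsOpen U ∧ K ⊆ U ∧ U ⊆ Ω ∧ MemBV μ u U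

/-- `φ ∈ BV_c(Ω)`: a BV function with compact support in `Ω`. -/
def MemBVc (μ : Measure X) (φ : X → ℝ) (Ω : Set X) : Prop :=
  MemBV μ φ Ω ∧ IsCompact (tsupport φ) ∧ tsupport φ ⊆ Ω

/-- `u` is a 1-minimizer (function of least gradient) in `Ω`. -/
def IsMinimizer (μ : Measure X) (u : X → ℝ) (Ω : Set X) : Prop :=
  MemBVloc μ u Ω ∧ ∀ φ : X → ℝ, MemBVc μ φ Ω →
    tvs μ u (tsupport φ) ≤ tvs μ (fun y => u y + φ y) (tsupport φ)

/-- `u` is a 1-superminimizer in `Ω`. -/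
def IsSuperminimizer (μ : Measure X) (u : X → ℝ) (Ω : Set X) : Prop :=
  MemBVloc μ u Ω ∧ ∀ φ : X → ℝ, MemBVc μ φ Ω → (∀ x, 0 ≤ φ x) →
    tvs μ u (tsupport φ) ≤ tvs μ (fun y => u y + φ y) (tsupport φ)

/-- `u` is a 1-subminimizer in `Ω`. -/
def IsSubminimizer (μ : Measure X) (u : X → ℝ) (Ω : Set X) : Prop :=
  MemBVloc μ u Ω ∧ ∀ φ : X → ℝ, MemBVc μ φ Ω → (∀ x, φ x ≤ 0) →
    tvs μ u (tsupport φ) ≤ tvs μ (fun y => u y + φ y) (tsupport φ)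

/-- The lower approximate limit `u^∧(x)`, with values in `[-∞,∞]`. -/
def lowerApprox (μ : Measure X) (u : X → ℝ) (x : X) : EReal :=
  sSup ((fun t : ℝ => (t : EReal)) '' {t : ℝ | Filter.Tendsto
    (fun r : ℝ => μ ({y | u y < t} ∩ Metric.ball x r) / μ (Metric.ball x r))
    (𝓝[>] (0 : ℝ)) (𝓝 0)})

/-- The upper approximate limit `u^∨(x)`, with values in `[-∞,∞]`. -/
def upperApprox (μ : Measure X) (u : X → ℝ) (x : X) : EReal :=
  sInf ((fun t : ℝ => (t : EReal)) '' {t : ℝ | Filter.Tendsto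
    (fun r : ℝ => μ ({y | t < u y} ∩ Metric.ball x r) / μ (Metric.ball x r))
    (𝓝[>] (0 : ℝ)) (𝓝 0)})

/-- The upper approximate limit of an extended-real-valued function. -/
def upperApproxE (μ : Measure X) (ψ : X → EReal) (x : X) : EReal :=
  sInf ((fun t : ℝ => (t : EReal)) '' {t : ℝ | Filter.Tendsto
    (fun r : ℝ => μ ({y | (t : EReal) < ψ y} ∩ Metric.ball x r) / μ (Metric.ball x r))
    (𝓝[>] (0 : ℝ)) (𝓝 0)})

/-- The measure-theoretic interior `I_E`. -/
def measInterior (μ : Measure X) (E : Set X) : Set X :=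
  {x : X | Filter.Tendsto (fun r : ℝ => μ (Metric.ball x r \ E) / μ (Metric.ball x r))
    (𝓝[>] (0 : ℝ)) (𝓝 0)}

/-- The measure-theoretic boundary `∂*E`. -/
def measBoundary (μ : Measure X) (E : Set X) : Set X :=
  {x : X | 0 < Filter.limsup (fun r : ℝ => μ (Metric.ball x r ∩ E) / μ (Metric.ball x r))
      (𝓝[>] (0 : ℝ)) ∧
    0 < Filter.limsup (fun r : ℝ => μ (Metric.ball x r \ E) / μ (Metric.ball x r))
      (𝓝[>] (0 : ℝ))}

/-- `A` is 1-thin at `x`. -/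
def IsThinAt (μ : Measure X) (A : Set X) (x : X) : Prop :=
  Filter.Tendsto (fun r : ℝ =>
      ENNReal.ofReal r * vcap1 μ (A ∩ Metric.ball x r) (Metric.ball x (2 * r))
        / μ (Metric.ball x r))
    (𝓝[>] (0 : ℝ)) (𝓝 0)

/-- `U` is 1-finely open. -/
def IsFinelyOpen (μ : Measure X) (U : Set X) : Prop :=
  ∀ x ∈ U, IsThinAt μ Uᶜ x

/-- The class `K_{ψ,f}(Ω)` of admissible functions for the obstacle problem. -/
def MemK (μ : Measure X) (ψ : X → EReal) (f : X → ℝ) (Ω : Set X) (u : X → ℝ) : Prop :=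
  MemBVloc μ u Set.univ ∧ (∀ᵐ x ∂μ, x ∈ Ω → ψ x ≤ (u x : EReal)) ∧
    (∀ᵐ x ∂μ, x ∉ Ω → u x = f x)

/-- `u` is a solution of the `K_{ψ,f}(Ω)`-obstacle problem. -/
def IsObstacleSolution (μ : Measure X) (ψ : X → EReal) (f : X → ℝ) (Ω : Set X)
    (u : X → ℝ) : Prop :=
  MemK μ ψ f Ω u ∧ ∀ v : X → ℝ, MemK μ ψ f Ω v → tv μ u Set.univ ≤ tv μ v Set.univ

/-- The standing assumptions: `(X,d,μ)` is a complete metric space with at least two points,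
`μ` is a doubling measure with constant `Cd`, and `X` supports a `(1,1)`-Poincaré inequality
with constants `CP`, `lam`. -/
structure MMS {X : Type*} [MetricSpace X] [MeasurableSpace X] (μ : Measure X)
    (Cd CP lam : ℝ) : Prop where
  complete : CompleteSpace X
  nontrivial : Nontrivial X
  hCd : 1 ≤ Cd
  hCP : 0 < CP
  hlam : 1 ≤ lam
  doubling : ∀ (x : X) (r : ℝ), 0 < r →
    0 < μ (Metric.ball x (2 * r)) ∧
    μ (Metric.ball x (2 * r)) ≤ ENNReal.ofReal Cd * μ (Metric.ball x r) ∧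
    μ (Metric.ball x r) < ⊤
  poincare : ∀ (x : X) (r : ℝ), 0 < r → ∀ u : X → ℝ, MeasureTheory.LocallyIntegrable u μ →
    ∀ g : X → ℝ≥0∞, Measurable g → IsUpperGradientOn g u Set.univ →
      ∫⁻ y in Metric.ball x r, ENNReal.ofReal |u y - ⨍ z in Metric.ball x r, u z ∂μ| ∂μ ≤
        ENNReal.ofReal (CP * r) * (μ (Metric.ball x r) / μ (Metric.ball x (lam * r))) *
          ∫⁻ y in Metric.ball x (lam * r), g y ∂μ


set_option linter.unusedSectionVars false

theorem speed_congr {γ γ' : ℝ → X} {t : ℝ} (h : γ =ᶠ[𝓝 t] γ') : speed γ t = speed γ' t := by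
  have hadd : Tendsto (fun s : ℝ => t + s) (𝓝[≠] 0) (𝓝 t) := by
    have : Tendsto (fun s : ℝ => t + s) (𝓝 0) (𝓝 (t + 0)) := by
      exact (continuous_const.add continuous_id).tendsto 0
    rw [add_zero] at this
    exact this.mono_left nhdsWithin_le_nhds
  refine limsup_congr ?_
  filter_upwards [hadd.eventually h] with s hs
  rw [hs, h.eq_of_nhds]

theorem speed_const (c : X) (t : ℝ) : speed (fun _ => c) t = 0 := by
  simp only [speed, dist_self, zero_div, ENNReal.ofReal_zero]
  exact limsup_const_bot

/-- The part of a curve between the times `a` and `b`, extended by constants. -/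
def Curve.restrict (γ : Curve X) (a b : ℝ) (ha : 0 ≤ a) (hab : a ≤ b) (hb : b ≤ 1) :
    Curve X where
  toFun t := γ.toFun (max a (min b t))
  lipschitz := by
    obtain ⟨K, hK⟩ := γ.lipschitz
    have hc : LipschitzWith 1 (fun t : ℝ => max a (min b t)) :=
      (LipschitzWith.id.const_min b).const_max a
    refine ⟨K * 1, hK.comp hc.lipschitzOnWith fun t _ => ?_⟩
    exact ⟨ha.trans (le_max_left _ _), (max_le hab (min_le_left _ _)).trans hb⟩

theorem speed_restrict_le (γ : Curve X) {a b : ℝ} (ha : 0 ≤ a) (hab : a ≤ b) (hb : b ≤ 1)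
    {t : ℝ} (hta : t ≠ a) (htb : t ≠ b) :
    speed (γ.restrict a b ha hab hb).toFun t ≤ (Ioo a b).indicator (speed γ.toFun) t := by
  rcases lt_or_gt_of_ne hta with h | h
  · have : (γ.restrict a b ha hab hb).toFun =ᶠ[𝓝 t] fun _ => γ.toFun a := by
      filter_upwards [Iio_mem_nhds h] with s hs
      simp only [Curve.restrict]
      rw [max_eq_left ((min_le_right _ _).trans (le_of_lt hs))]
    rw [speed_congr this, speed_const]
    exact zero_le
  rcases lt_or_gt_of_ne htb with h' | h'
  · have : (γ.restrict a b ha hab hb).toFun =ᶠ[𝓝 t] γ.toFun := by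
      filter_upwards [Ioo_mem_nhds h h'] with s hs
      simp only [Curve.restrict]
      rw [min_eq_right hs.2.le, max_eq_right hs.1.le]
    rw [speed_congr this, indicator_of_mem (show t ∈ Ioo a b from ⟨h, h'⟩)]
  · have : (γ.restrict a b ha hab hb).toFun =ᶠ[𝓝 t] fun _ => γ.toFun b := by
      filter_upwards [Ioi_mem_nhds h'] with s hs
      simp only [Curve.restrict]
      rw [min_eq_left (le_of_lt hs), max_eq_right hab]
    rw [speed_congr this, speed_const]
    exact zero_le

theorem IsUpperGradientOn.le_setLIntegral {g : X → ℝ≥0∞} {u : X → ℝ}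
    (hg : IsUpperGradientOn g u univ) (γ : Curve X) {a b : ℝ}
    (ha : 0 ≤ a) (hab : a ≤ b) (hb : b ≤ 1) :
    ENNReal.ofReal |u (γ.toFun b) - u (γ.toFun a)| ≤
      ∫⁻ t in Ioo a b, g (γ.toFun t) * speed γ.toFun t := by
  have h := hg (γ.restrict a b ha hab hb) fun _ _ => mem_univ _
  have h1 : (γ.restrict a b ha hab hb).toFun 1 = γ.toFun b := by
    simp [Curve.restrict, min_eq_left hb, max_eq_right hab]
  have h0 : (γ.restrict a b ha hab hb).toFun 0 = γ.toFun a := by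
    simp only [Curve.restrict]
    rw [max_eq_left ((min_le_right _ _).trans ha)]
  rw [h1, h0] at h
  refine h.trans ?_
  calc curveIntegral g (γ.restrict a b ha hab hb)
      ≤ ∫⁻ t in Icc (0 : ℝ) 1,
          (Ioo a b).indicator (fun t => g (γ.toFun t) * speed γ.toFun t) t := by
        refine lintegral_mono_ae ?_
        have hne : ∀ c : ℝ, ∀ᵐ t ∂(volume.restrict (Icc (0 : ℝ) 1)), t ≠ c := fun c =>
          ae_restrict_of_ae (Measure.ae_ne volume c)
        filter_upwards [hne a, hne b] with t hta htb
        refine (mul_le_mul_right (speed_restrict_le γ ha hab hb hta htb) _).trans ?_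
        by_cases ht : t ∈ Ioo a b
        · rw [indicator_of_mem ht, indicator_of_mem ht]
          simp only [Curve.restrict]
          rw [min_eq_right ht.2.le, max_eq_right ht.1.le]
        · simp [indicator_of_notMem ht]
    _ = ∫⁻ t in Ioo a b, g (γ.toFun t) * speed γ.toFun t := by
        rw [lintegral_indicator measurableSet_Ioo, Measure.restrict_restrict measurableSet_Ioo,
          inter_eq_left.2]
        exact Ioo_subset_Icc_self.trans (Icc_subset_Icc ha hb)

theorem IsUpperGradientOn.continuousOn_comp {g : X → ℝ≥0∞} {u : X → ℝ}
    (hg : IsUpperGradientOn g u univ) (γ : Curve X) (hγ : curveIntegral g γ ≠ ⊤) :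
    ContinuousOn (fun t => u (γ.toFun t)) (Icc 0 1) := by
  rw [Metric.continuousOn_iff]
  intro s hs ε hε
  obtain ⟨δ, hδ, H⟩ := exists_pos_setLIntegral_lt_of_measure_lt hγ
    (ε := ENNReal.ofReal ε) (by simpa using hε)
  have key : ∀ a b : ℝ, 0 ≤ a → a ≤ b → b ≤ 1 → ENNReal.ofReal (b - a) < δ →
      |u (γ.toFun b) - u (γ.toFun a)| < ε := by
    intro a b ha hab hb hlt
    have hsub : Ioo a b ⊆ Icc (0 : ℝ) 1 := Ioo_subset_Icc_self.trans (Icc_subset_Icc ha hb)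
    have h := H (Ioo a b) (by
      rw [Measure.restrict_apply measurableSet_Ioo, inter_eq_left.2 hsub, Real.volume_Ioo]
      exact hlt)
    rw [Measure.restrict_restrict measurableSet_Ioo, inter_eq_left.2 hsub] at h
    exact (ENNReal.ofReal_lt_ofReal_iff hε).1 ((hg.le_setLIntegral γ ha hab hb).trans_lt h)
  obtain ⟨d, hd, hdδ⟩ : ∃ d : ℝ, 0 < d ∧ ENNReal.ofReal d ≤ δ := by
    rcases eq_or_ne δ ⊤ with h | h
    · exact ⟨1, one_pos, by simp [h]⟩
    · exact ⟨δ.toReal, ENNReal.toReal_pos hδ.ne' h, (ENNReal.ofReal_toReal h).le⟩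
  refine ⟨d, hd, fun t ht hts => ?_⟩
  rw [Real.dist_eq] at hts ⊢
  have hlt : ∀ c : ℝ, c < d → ENNReal.ofReal c < δ := fun c hc =>
    ((ENNReal.ofReal_lt_ofReal_iff hd).2 hc).trans_le hdδ
  rcases le_total s t with h | h
  · exact key s t hs.1 h ht.2 (hlt _ ((le_abs_self _).trans_lt hts))
  · rw [abs_sub_comm] at hts ⊢
    exact key t s ht.1 h hs.2 (hlt _ ((le_abs_self _).trans_lt hts))

theorem exists_crossing {φ : ℝ → ℝ} (hφ : ContinuousOn φ (Icc 0 1)) {α β : ℝ}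
    (h0 : φ 0 ≤ α) (h1 : β ≤ φ 1) :
    ∃ a b : ℝ, 0 ≤ a ∧ a ≤ b ∧ b ≤ 1 ∧ β - α ≤ φ b - φ a ∧
      ∀ t ∈ Ioo a b, α < φ t ∧ φ t < β := by
  have hK : IsCompact (Icc (0 : ℝ) 1 ∩ φ ⁻¹' Ici β) :=
    isCompact_Icc.of_isClosed_subset (hφ.preimage_isClosed_of_isClosed isClosed_Icc isClosed_Ici)
      inter_subset_left
  obtain ⟨b, ⟨hb, hbβ⟩, hbl⟩ := hK.exists_isLeast ⟨1, ⟨by simp, h1⟩⟩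
  have hφb : ContinuousOn φ (Icc 0 b) := hφ.mono (Icc_subset_Icc_right hb.2)
  have hL : IsCompact (Icc (0 : ℝ) b ∩ φ ⁻¹' Iic α) :=
    isCompact_Icc.of_isClosed_subset (hφb.preimage_isClosed_of_isClosed isClosed_Icc isClosed_Iic)
      inter_subset_left
  obtain ⟨a, ⟨ha, haα⟩, hag⟩ := hL.exists_isGreatest ⟨0, ⟨⟨le_rfl, hb.1⟩, h0⟩⟩
  refine ⟨a, b, ha.1, ha.2, hb.2, sub_le_sub hbβ haα, fun t ht => ⟨?_, ?_⟩⟩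
  · by_contra! h
    exact absurd (hag ⟨⟨ha.1.trans ht.1.le, ht.2.le⟩, h⟩) (not_le.2 ht.1)
  · by_contra! h
    exact absurd (hbl ⟨⟨ha.1.trans ht.1.le, ht.2.le.trans hb.2⟩, h⟩) (not_le.2 ht.2)

theorem mod1_curveIntegral_eq_top (μ : Measure X) {g : X → ℝ≥0∞} (hg : Measurable g)
    (hfin : ∫⁻ x, g x ∂μ ≠ ⊤) : Mod1 μ {γ | curveIntegral g γ = ⊤} = 0 := by
  have hle : ∀ n : ℕ, Mod1 μ {γ | curveIntegral g γ = ⊤} ≤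
      (n + 1 : ℝ≥0∞)⁻¹ * ∫⁻ x, g x ∂μ := by
    intro n
    have hn : (n + 1 : ℝ≥0∞)⁻¹ ≠ ⊤ := by simp
    have hn0 : (n + 1 : ℝ≥0∞)⁻¹ ≠ 0 := by simp
    rw [← lintegral_const_mul' _ _ hn]
    refine iInf₂_le_of_le (fun x => (n + 1 : ℝ≥0∞)⁻¹ * g x) (hg.const_mul _) ?_
    refine iInf_le_of_le ?_ le_rfl
    intro γ hγ
    have : curveIntegral (fun x => (n + 1 : ℝ≥0∞)⁻¹ * g x) γ =
        (n + 1 : ℝ≥0∞)⁻¹ * curveIntegral g γ := by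
      simp only [curveIntegral, mul_assoc]
      rw [lintegral_const_mul' _ _ hn]
    rw [this, show curveIntegral g γ = ⊤ from hγ, ENNReal.mul_top hn0]
    exact le_top
  refine le_antisymm (ge_of_tendsto' (f := fun n : ℕ => (n + 1 : ℝ≥0∞)⁻¹ * ∫⁻ x, g x ∂μ)
    (x := atTop) ?_ hle) zero_le
  have h1 : Tendsto (fun n : ℕ => (n + 1 : ℝ≥0∞)⁻¹) atTop (𝓝 0) := by
    have := (tendsto_add_atTop_iff_nat 1).2 ENNReal.tendsto_inv_nat_nhds_zero
    simpa using this
  simpa using ENNReal.Tendsto.mul_const h1 (Or.inr hfin)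

theorem IsUpperGradientOn.truncate {μ : Measure X} {g : X → ℝ≥0∞} {u : X → ℝ}
    (hg : IsUpperGradientOn g u univ) (hgm : Measurable g) (hfin : ∫⁻ x, g x ∂μ ≠ ⊤)
    {p q : ℝ} (hpq : p ≤ q) {S : Set X} (hS : ∀ x, p < u x → u x < q → x ∈ S) :
    IsWeakUpperGradientOn μ (S.indicator g) (fun x => max p (min q (u x))) univ := by
  refine ⟨_, mod1_curveIntegral_eq_top μ hgm hfin, fun γ hγ _ => ?_⟩
  have hcont := hg.continuousOn_comp γ hγ
  have hcross : ∀ a b : ℝ, 0 ≤ a → a ≤ b → b ≤ 1 →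
      (∀ t ∈ Ioo a b, p < u (γ.toFun t) ∧ u (γ.toFun t) < q) →
      ENNReal.ofReal |u (γ.toFun b) - u (γ.toFun a)| ≤ curveIntegral (S.indicator g) γ := by
    intro a b ha hab hb h
    refine (hg.le_setLIntegral γ ha hab hb).trans ?_
    calc ∫⁻ t in Ioo a b, g (γ.toFun t) * speed γ.toFun t
        = ∫⁻ t in Ioo a b, S.indicator g (γ.toFun t) * speed γ.toFun t := by
          refine setLIntegral_congr_fun measurableSet_Ioo fun t ht => ?_
          rw [indicator_of_mem (hS _ (h t ht).1 (h t ht).2)]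
      _ ≤ _ := lintegral_mono_set (Ioo_subset_Icc_self.trans (Icc_subset_Icc ha hb))
  set α := max p (min q (u (γ.toFun 0))) with hα
  set β := max p (min q (u (γ.toFun 1))) with hβ
  have hpα : p ≤ α := le_max_left _ _
  have hpβ : p ≤ β := le_max_left _ _
  have hαq : α ≤ q := max_le hpq (min_le_left _ _)
  have hβq : β ≤ q := max_le hpq (min_le_left _ _)
  have hup : ∀ w c : ℝ, max p (min q w) < c → c ≤ q → w ≤ max p (min q w) := by
    intro w c h hc
    rcases le_total q w with h' | h'
    · rw [min_eq_left h'] at h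
      exact absurd ((le_max_right p q).trans_lt h) (not_lt.2 hc)
    · rw [min_eq_right h']
      exact le_max_right _ _
  have hlo : ∀ w c : ℝ, c < max p (min q w) → p ≤ c → max p (min q w) ≤ w := by
    intro w c h hc
    rcases le_total (min q w) p with h' | h'
    · rw [max_eq_left h'] at h
      exact absurd h (not_lt.2 hc)
    · rw [max_eq_right h']
      exact min_le_right _ _
  change ENNReal.ofReal |β - α| ≤ _
  rcases lt_trichotomy α β with h | h | h
  · obtain ⟨a, b, ha, hab, hb, hd, hin⟩ := exists_crossing hcont (hup _ _ h hβq) (hlo _ _ h hpα)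
    refine le_trans (ENNReal.ofReal_le_ofReal ?_) (hcross a b ha hab hb fun t ht =>
      ⟨hpα.trans_lt (hin t ht).1, (hin t ht).2.trans_le hβq⟩)
    rw [abs_of_pos (sub_pos.2 h)]
    exact hd.trans (le_abs_self _)
  · rw [h, sub_self, abs_zero, ENNReal.ofReal_zero]
    exact zero_le
  · obtain ⟨a, b, ha, hab, hb, hd, hin⟩ := exists_crossing hcont.neg
      (neg_le_neg (hlo _ _ h hpβ)) (neg_le_neg (hup _ _ h hαq))
    simp only [Pi.neg_apply, neg_lt_neg_iff] at hin
    refine le_trans (ENNReal.ofReal_le_ofReal ?_) (hcross a b ha hab hb fun t ht =>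
      ⟨hpβ.trans_lt (hin t ht).2, (hin t ht).1.trans_le hαq⟩)
    rw [abs_sub_comm, abs_of_pos (sub_pos.2 h), abs_sub_comm]
    refine le_trans ?_ (le_abs_self _)
    simp only [Pi.neg_apply] at hd
    linarith

theorem exists_curveIntegral_eq_top {μ : Measure X} {Γ : Set (Curve X)} (hΓ : Mod1 μ Γ = 0)
    {δ : ℝ≥0∞} (hδ : δ ≠ 0) :
    ∃ ρ : X → ℝ≥0∞, Measurable ρ ∧ ∫⁻ x, ρ x ∂μ < δ ∧ ∀ γ ∈ Γ, curveIntegral ρ γ = ⊤ := by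
  obtain ⟨ε, hε, hsum⟩ := ENNReal.exists_pos_sum_of_countable' hδ ℕ
  have : ∀ n, ∃ ρ : X → ℝ≥0∞, Measurable ρ ∧ (∀ γ ∈ Γ, 1 ≤ curveIntegral ρ γ) ∧
      ∫⁻ x, ρ x ∂μ < ε n := by
    intro n
    have h : Mod1 μ Γ < ε n := hΓ ▸ hε n
    simp only [Mod1, iInf_lt_iff] at h
    obtain ⟨ρ, hρ, hΓρ, hlt⟩ := h
    exact ⟨ρ, hρ, hΓρ, hlt⟩
  choose ρ hρ hΓρ hlt using this
  refine ⟨fun x => ∑' n, ρ n x, Measurable.tsum hρ, ?_, fun γ hγ => ?_⟩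
  · rw [lintegral_tsum fun n => (hρ n).aemeasurable]
    exact (ENNReal.tsum_le_tsum fun n => (hlt n).le).trans_lt hsum
  · have hfinite : ∀ n : ℕ, (n : ℝ≥0∞) ≤ ∫⁻ t in Icc (0 : ℝ) 1,
        ∑ i ∈ Finset.range n, ρ i (γ.toFun t) * speed γ.toFun t := by
      intro n
      induction n with
      | zero => simp
      | succ n ih =>
        simp only [Finset.sum_range_succ]
        refine le_trans ?_ (le_lintegral_add _ _)
        push_cast
        exact add_le_add ih (hΓρ n γ hγ)
    refine ENNReal.eq_top_of_forall_nnreal_le fun c => ?_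
    obtain ⟨n, hn⟩ := exists_nat_ge c
    refine le_trans (by exact_mod_cast hn) ((hfinite n).trans ?_)
    refine lintegral_mono fun t => ?_
    simp only
    rw [← Finset.sum_mul]
    exact mul_le_mul_left (ENNReal.sum_le_tsum _) _

theorem IsWeakUpperGradientOn.exists_isUpperGradientOn {μ : Measure X} {g : X → ℝ≥0∞}
    {u : X → ℝ} (hg : IsWeakUpperGradientOn μ g u univ) (hgm : Measurable g)
    {δ : ℝ≥0∞} (hδ : δ ≠ 0) :
    ∃ g' : X → ℝ≥0∞, Measurable g' ∧ IsUpperGradientOn g' u univ ∧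
      ∫⁻ x, g' x ∂μ ≤ ∫⁻ x, g x ∂μ + δ := by
  obtain ⟨Γ, hΓ, h⟩ := hg
  obtain ⟨ρ, hρ, hρδ, htop⟩ := exists_curveIntegral_eq_top hΓ hδ
  refine ⟨g + ρ, hgm.add hρ, fun γ hγ => ?_, ?_⟩
  · by_cases hmem : γ ∈ Γ
    · have : curveIntegral ρ γ ≤ curveIntegral (g + ρ) γ :=
        lintegral_mono fun t => mul_le_mul_left (le_add_self) _
      rw [htop γ hmem] at this
      exact le_top.trans this
    · exact (h γ hmem hγ).trans (lintegral_mono fun t => mul_le_mul_left (le_self_add) _)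
  · simp only [Pi.add_apply]
    rw [lintegral_add_left hgm]
    gcongr

section Doubling

variable {μ : Measure X} {Cd CP lam : ℝ}

theorem MMS.measure_ball_ne_zero (hM : MMS μ Cd CP lam) (x : X) {r : ℝ} (hr : 0 < r) :
    μ (ball x r) ≠ 0 := by
  have := (hM.doubling x (r / 2) (half_pos hr)).1
  rw [mul_div_cancel₀ r two_ne_zero] at this
  exact this.ne'

theorem MMS.measure_ball_ne_top (hM : MMS μ Cd CP lam) (x : X) {r : ℝ} (hr : 0 < r) :
    μ (ball x r) ≠ ⊤ :=
  (hM.doubling x r hr).2.2.ne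

theorem MMS.locallyIntegrable_of_bounded (hM : MMS μ Cd CP lam) {v : X → ℝ}
    (hv : AEStronglyMeasurable v μ) {C : ℝ} (hC : ∀ x, |v x| ≤ C) : LocallyIntegrable v μ := by
  intro x
  refine ⟨ball x 1, ball_mem_nhds x one_pos, ?_⟩
  exact Measure.integrableOn_of_bounded (hM.measure_ball_ne_top x one_pos) hv
    (Eventually.of_forall hC)

theorem MMS.poincare_weak (hM : MMS μ Cd CP lam) (x : X) {r : ℝ} (hr : 0 < r) {v : X → ℝ}
    (hv : LocallyIntegrable v μ) {g : X → ℝ≥0∞} (hgm : Measurable g)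
    (hg : IsWeakUpperGradientOn μ g v univ) :
    ∫⁻ y in ball x r, ENNReal.ofReal |v y - ⨍ z in ball x r, v z ∂μ| ∂μ ≤
      ENNReal.ofReal (CP * r) * ∫⁻ y, g y ∂μ := by
  have h : ∀ δ : ℝ≥0∞, δ ≠ 0 →
      ∫⁻ y in ball x r, ENNReal.ofReal |v y - ⨍ z in ball x r, v z ∂μ| ∂μ ≤
        ENNReal.ofReal (CP * r) * (∫⁻ y, g y ∂μ + δ) := by
    intro δ hδ
    obtain ⟨g', hg'm, hg', hle⟩ := hg.exists_isUpperGradientOn hgm hδ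
    refine (hM.poincare x r hr v hv g' hg'm hg').trans ?_
    have hratio : μ (ball x r) / μ (ball x (lam * r)) ≤ 1 :=
      ENNReal.div_le_of_le_mul (by
        rw [one_mul]
        exact measure_mono (ball_subset_ball (le_mul_of_one_le_left hr.le hM.hlam)))
    refine mul_le_mul' (mul_le_of_le_one_right' hratio) ?_
    exact (setLIntegral_le_lintegral _ _).trans hle
  have hlim : Tendsto (fun δ : ℝ≥0∞ => ENNReal.ofReal (CP * r) * (∫⁻ y, g y ∂μ + δ)) (𝓝[≠] 0)
      (𝓝 (ENNReal.ofReal (CP * r) * (∫⁻ y, g y ∂μ + 0))) := by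
    refine ENNReal.Tendsto.const_mul ?_ (Or.inr ENNReal.ofReal_ne_top)
    exact (tendsto_const_nhds.add tendsto_id).mono_left nhdsWithin_le_nhds
  rw [add_zero] at hlim
  exact ge_of_tendsto hlim (eventually_mem_nhdsWithin.mono h)

theorem MMS.jump_le [BorelSpace X] (hM : MMS μ Cd CP lam) (x : X) {r : ℝ} (hr : 0 < r)
    {v : X → ℝ} (hv : LocallyIntegrable v μ) (hvm : AEStronglyMeasurable v μ)
    {g : X → ℝ≥0∞} (hgm : Measurable g)
    (hg : IsWeakUpperGradientOn μ g v univ) {p q : ℝ} {m : ℝ≥0∞}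
    (hp : m ≤ μ ({y | v y ≤ p} ∩ ball x r)) (hq : m ≤ μ ({y | q ≤ v y} ∩ ball x r)) :
    ENNReal.ofReal ((q - p) / 2) * m ≤ ENNReal.ofReal (CP * r) * ∫⁻ y, g y ∂μ := by
  refine le_trans ?_ (hM.poincare_weak x hr hv hgm hg)
  set k := ⨍ z in ball x r, v z ∂μ
  set F : X → ℝ≥0∞ := fun y => ENNReal.ofReal |v y - k| with hF
  have hFm : AEMeasurable F (μ.restrict (ball x r)) :=
    (continuous_abs.measurable.comp_aemeasurable
      (hvm.aemeasurable.restrict.sub_const k)).ennreal_ofReal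
  refine le_trans ?_ (mul_meas_ge_le_lintegral₀ hFm (ENNReal.ofReal ((q - p) / 2)))
  rw [Measure.restrict_apply' measurableSet_ball]
  gcongr
  rcases le_total k ((p + q) / 2) with h | h
  · refine hq.trans (measure_mono (inter_subset_inter_left _ fun y hy => ?_))
    refine ENNReal.ofReal_le_ofReal (le_trans ?_ (le_abs_self _))
    have : q ≤ v y := hy
    linarith
  · refine hp.trans (measure_mono (inter_subset_inter_left _ fun y hy => ?_))
    refine ENNReal.ofReal_le_ofReal (le_trans ?_ (neg_le_abs _))
    have : v y ≤ p := hy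
    linarith

theorem MMS.exists_dist_eq [BorelSpace X] (hM : MMS μ Cd CP lam) {x z : X} {d : ℝ} (hd : 0 < d)
    (hz : d < dist z x) : ∃ y, dist y x = d := by
  by_contra! hne
  have hHm : MeasurableSet (ball x d) := measurableSet_ball
  have hvm : AEStronglyMeasurable (chi (ball x d)) μ :=
    (measurable_const.indicator hHm).aestronglyMeasurable
  have hv : LocallyIntegrable (chi (ball x d)) μ :=
    hM.locallyIntegrable_of_bounded hvm (C := 1) fun y => by
      by_cases hy : y ∈ ball x d <;> simp [chi, hy]
  have hconst : ∀ γ : Curve X,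
      (γ.toFun 0 ∈ ball x d ↔ γ.toFun 1 ∈ ball x d) := by
    intro γ
    obtain ⟨K, hK⟩ := γ.lipschitz
    have hc : ContinuousOn (fun t => dist (γ.toFun t) x) (Icc 0 1) :=
      (continuous_id.dist continuous_const).comp_continuousOn hK.continuousOn
    have hmiss : ∀ t ∈ Icc (0 : ℝ) 1, dist (γ.toFun t) x ≠ d := fun t _ => hne _
    simp only [mem_ball]
    constructor
    · intro h
      by_contra! h'
      obtain ⟨t, ht, hd⟩ := intermediate_value_Icc zero_le_one hc ⟨h.le, h'⟩
      exact hmiss t ht hd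
    · intro h
      by_contra! h'
      obtain ⟨t, ht, hd⟩ := intermediate_value_Icc' zero_le_one hc ⟨h.le, h'⟩
      exact hmiss t ht hd
  have hg : IsWeakUpperGradientOn μ (fun _ => 0) (chi (ball x d)) univ := by
    refine ⟨∅, ?_, fun γ _ _ => ?_⟩
    · refine le_antisymm (iInf₂_le_of_le (fun _ => 0) measurable_const ?_) zero_le
      exact iInf_le_of_le (by simp) (by simp)
    · have : chi (ball x d) (γ.toFun 1) = chi (ball x d) (γ.toFun 0) := by
        by_cases h : γ.toFun 0 ∈ ball x d
        · simp only [chi]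
          rw [indicator_of_mem h, indicator_of_mem ((hconst γ).1 h)]
        · simp only [chi]
          rw [indicator_of_notMem h, indicator_of_notMem (mt (hconst γ).2 h)]
      simp [this]
  have hr : 0 < dist z x + 1 := by positivity
  have hjump := fun m hp hq => hM.jump_le x hr hv hvm measurable_const hg (p := 0) (q := 1)
    (m := m) hp hq
  obtain ⟨e, he, hsub⟩ : ∃ e > 0, ball z e ⊆ {y | chi (ball x d) y ≤ 0} ∩ ball x (dist z x + 1) := by
    refine ⟨min (dist z x - d) 1, lt_min (sub_pos.2 hz) one_pos, fun y hy => ?_⟩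
    rw [mem_ball, lt_min_iff] at hy
    have h1 := dist_triangle z y x
    have h2 := dist_triangle y z x
    rw [dist_comm z y] at h1
    refine ⟨?_, ?_⟩
    · have : y ∉ ball x d := by
        rw [mem_ball, not_lt]
        linarith
      simp [chi, this]
    · rw [mem_ball]
      linarith
  have hsub' : ball x d ⊆ {y | 1 ≤ chi (ball x d) y} ∩ ball x (dist z x + 1) := by
    refine fun y hy => ⟨?_, ball_subset_ball (by linarith) hy⟩
    simp only [chi]
    rw [mem_ofPred_eq, indicator_of_mem hy]
  have := hjump (min (μ (ball z e)) (μ (ball x d))) ((min_le_left _ _).trans (measure_mono hsub))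
    ((min_le_right _ _).trans (measure_mono hsub'))
  rw [lintegral_const, zero_mul, mul_zero, nonpos_iff_eq_zero, mul_eq_zero] at this
  rcases this with h | h
  · norm_num at h
  · have hpos : 0 < min (μ (ball z e)) (μ (ball x d)) :=
      lt_min (pos_iff_ne_zero.2 (hM.measure_ball_ne_zero z he))
        (pos_iff_ne_zero.2 (hM.measure_ball_ne_zero x hd))
    exact hpos.ne' h

theorem MMS.measure_ball_le_annulus [BorelSpace X] (hM : MMS μ Cd CP lam) (x : X) {r : ℝ}
    (hr : 0 < r) (hdiam : ENNReal.ofReal r < Metric.ediam (univ : Set X) / 8) :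
    μ (ball x (4 * r)) ≤ ENNReal.ofReal Cd ^ 3 * μ (ball x (4 * r) \ ball x (2 * r)) := by
  obtain ⟨z, hz⟩ : ∃ z, 3 * r < dist z x := by
    by_contra! h
    refine absurd hdiam (not_lt.2 (ENNReal.div_le_of_le_mul ?_))
    refine Metric.ediam_le fun a _ b _ => ?_
    rw [edist_dist]
    have h8 : (8 : ℝ≥0∞) = ENNReal.ofReal 8 := by norm_num
    rw [h8, ← ENNReal.ofReal_mul hr.le]
    refine ENNReal.ofReal_le_ofReal ?_
    linarith [dist_triangle_right a b x, h a, h b]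
  obtain ⟨y, hy⟩ := hM.exists_dist_eq (by positivity) hz
  have hd := fun s hs => (hM.doubling y s hs).2.1
  have h1 := hd r hr
  have h2 := hd (2 * r) (by positivity)
  have h3 := hd (2 * (2 * r)) (by positivity)
  calc μ (ball x (4 * r)) ≤ μ (ball y (2 * (2 * (2 * r)))) :=
        measure_mono (ball_subset_ball' (by rw [dist_comm, hy]; linarith))
    _ ≤ ENNReal.ofReal Cd * (ENNReal.ofReal Cd * (ENNReal.ofReal Cd * μ (ball y r))) := by
        refine h3.trans ?_
        gcongr
        refine h2.trans ?_
        gcongr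
    _ = ENNReal.ofReal Cd ^ 3 * μ (ball y r) := by ring
    _ ≤ _ := by
        gcongr
        intro w hw
        rw [mem_ball] at hw
        refine ⟨?_, ?_⟩
        · rw [mem_ball]
          linarith [dist_triangle w y x]
        · rw [mem_ball, not_lt]
          linarith [dist_triangle_left y x w]

end Doubling

theorem exists_balanced_scale {b l h s : ℕ → ℝ≥0∞} {D : ℝ≥0∞} (hD : 1 ≤ D) {J : ℕ}
    (hb : ∀ j, b j ≠ ⊤) (hcover : ∀ j ≤ J, b j ≤ l j + h j + s j) (hs : ∀ j ≤ J, 4 * s j ≤ b j)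
    (hmono : ∀ j, h (j + 1) ≤ h j) (hdouble : ∀ j, b j ≤ D * b (j + 1))
    (h0 : b 0 ≤ D ^ 3 * l 0) (hJ : b J ≤ 2 * D * h J) :
    ∃ j ≤ J, b j ≤ 4 * D ^ 3 * l j ∧ b j ≤ 4 * D ^ 3 * h j := by
  have hD3 : D ≤ D ^ 3 := le_self_pow₀ hD (by norm_num)
  have h24 : 2 * D ≤ 4 * D ^ 3 := mul_le_mul' (by norm_num) hD3
  induction J with
  | zero =>
    refine ⟨0, le_rfl, h0.trans ?_, hJ.trans (mul_le_mul_left h24 _)⟩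
    gcongr
    exact le_mul_of_one_le_left' (by norm_num)
  | succ J ih =>
    by_cases hl : b (J + 1) ≤ 4 * D ^ 3 * l (J + 1)
    · exact ⟨J + 1, le_rfl, hl, hJ.trans (mul_le_mul_left h24 _)⟩
    have hl4 : 4 * l (J + 1) ≤ b (J + 1) := by
      refine le_trans ?_ (not_le.1 hl).le
      gcongr
      exact le_mul_of_one_le_right' (hD.trans hD3)
    have hbh : b (J + 1) ≤ 2 * h (J + 1) := by
      have h4 : 2 * b (J + 1) + 2 * b (J + 1) ≤ 2 * b (J + 1) + 2 * (2 * h (J + 1)) :=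
        calc 2 * b (J + 1) + 2 * b (J + 1) = 4 * b (J + 1) := by ring
          _ ≤ 4 * (l (J + 1) + h (J + 1) + s (J + 1)) := by
              gcongr
              exact hcover _ le_rfl
          _ = 4 * l (J + 1) + 4 * s (J + 1) + 4 * h (J + 1) := by ring
          _ ≤ b (J + 1) + b (J + 1) + 4 * h (J + 1) := by
              gcongr
              exact hs _ le_rfl
          _ = 2 * b (J + 1) + 2 * (2 * h (J + 1)) := by ring
      have h5 := (ENNReal.add_le_add_iff_left (ENNReal.mul_ne_top (by simp) (hb _))).1 h4
      exact (ENNReal.mul_le_mul_iff_right (by simp) (by simp)).1 h5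
    obtain ⟨j, hj, hjl⟩ := ih (fun j hj => hcover j (hj.trans J.le_succ))
      (fun j hj => hs j (hj.trans J.le_succ)) <|
        calc b J ≤ D * b (J + 1) := hdouble J
          _ ≤ D * (2 * h J) := by
              gcongr
              exact hbh.trans (by gcongr; exact hmono J)
          _ = 2 * D * h J := by ring
    exact ⟨j, hj.trans J.le_succ, hjl⟩

theorem exists_nat_mul_measure_le {α : Type*} [MeasurableSpace α] (ν : Measure α)
    {T : ℕ → Set α} (hT : ∀ i, MeasurableSet (T i)) (hdisj : Pairwise (Function.onFun Disjoint T))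
    {N : ℕ} (hN : 0 < N) : ∃ i < N, N * ν (T i) ≤ ν univ := by
  by_contra! h
  have hsum : ∑ i ∈ Finset.range N, ν (T i) ≤ ν univ := by
    rw [← measure_biUnion_finset (fun i _ j _ hij => hdisj hij) fun i _ => hT i]
    exact measure_mono (subset_univ _)
  have hlt : ∑ _i ∈ Finset.range N, ν univ < ∑ i ∈ Finset.range N, (N : ℝ≥0∞) * ν (T i) :=
    ENNReal.sum_lt_sum_of_nonempty ⟨0, Finset.mem_range.2 hN⟩ fun i hi =>
      h i (Finset.mem_range.1 hi)
  rw [Finset.sum_const, Finset.card_range, nsmul_eq_mul, ← Finset.mul_sum] at hlt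
  exact absurd (mul_le_mul_right hsum (N : ℝ≥0∞)) (not_le.2 hlt)

theorem exists_thin_layer {μ : Measure X} {g : X → ℝ≥0∞} {f : X → ℝ} (hf : Measurable f)
    {B : ℕ → Set X} (hB0 : ∀ j, μ (B j) ≠ 0)
    (hBtop : ∀ j, μ (B j) ≠ ⊤) (J : ℕ) {τ : ℝ≥0∞} (hτ : τ ≠ ⊤) (hlt : ∫⁻ y, g y ∂μ < τ) :
    ∃ N : ℕ, 0 < N ∧ ∃ i < N,
      N * ∫⁻ y in f ⁻¹' Ioo (i / N : ℝ) ((i + 1) / N), g y ∂μ ≤ τ ∧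
      ∀ j ≤ J, 4 * μ (f ⁻¹' Ioo (i / N : ℝ) ((i + 1) / N) ∩ B j) ≤ μ (B j) := by
  set η : ℝ≥0∞ := (τ - ∫⁻ y, g y ∂μ) / (J + 1) with hη
  have hη0 : η ≠ 0 := by
    simp only [hη, ne_eq, ENNReal.div_eq_zero_iff, not_or]
    exact ⟨(tsub_pos_of_lt hlt).ne', by simp⟩
  have hηtop : η ≠ ⊤ := ENNReal.div_ne_top (ENNReal.sub_ne_top hτ) (by simp)
  have hητ : ∫⁻ y, g y ∂μ + (J + 1) * η = τ := by
    rw [hη, ENNReal.mul_div_cancel (by simp) (by simp), add_tsub_cancel_of_le hlt.le]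
  set ν : Measure X := μ.withDensity g +
    ∑ j ∈ Finset.range (J + 1), (η / μ (B j)) • μ.restrict (B j) with hν
  have hνapp : ∀ T, MeasurableSet T → ν T = ∫⁻ y in T, g y ∂μ +
      ∑ j ∈ Finset.range (J + 1), η / μ (B j) * μ (T ∩ B j) := by
    intro T hT
    rw [hν, Measure.add_apply, withDensity_apply _ hT, Measure.finsetSum_apply]
    congr 1
    refine Finset.sum_congr rfl fun j _ => ?_
    rw [Measure.smul_apply, Measure.restrict_apply hT, smul_eq_mul]
  have hνuniv : ν univ = τ := by
    rw [hνapp _ MeasurableSet.univ, ← hητ, Measure.restrict_univ]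
    congr 1
    rw [Finset.sum_congr rfl fun j _ => show η / μ (B j) * μ (univ ∩ B j) = η by
      rw [univ_inter, ENNReal.div_mul_cancel (hB0 j) (hBtop j)]]
    simp
  obtain ⟨N, hN⟩ := ENNReal.exists_nat_gt (r := 4 * τ / η)
    (ENNReal.div_ne_top (ENNReal.mul_ne_top (by simp) hτ) hη0)
  have hN0 : 0 < N := by exact_mod_cast lt_of_le_of_lt (zero_le (a := 4 * τ / η)) hN
  have hNr : (0 : ℝ) < N := by exact_mod_cast hN0
  have hNη : 4 * τ ≤ N * η := (ENNReal.div_le_iff hη0 hηtop).1 hN.le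
  set T : ℕ → Set X := fun i => f ⁻¹' Ioo (i / N : ℝ) ((i + 1) / N) with hTdef
  have hT : ∀ i, MeasurableSet (T i) := fun i => hf measurableSet_Ioo
  have hdisj : Pairwise (Function.onFun Disjoint T) := by
    refine (pairwise_disjoint_on T).2 fun i k hik => disjoint_left.2 fun y hy hy' => ?_
    have h1 : f y < (i + 1) / N := hy.2
    have h2 : (k : ℝ) / N < f y := hy'.1
    have h3 : ((i : ℝ) + 1) / N ≤ k / N := by
      gcongr
      exact_mod_cast hik
    linarith
  obtain ⟨i, hiN, hi⟩ := exists_nat_mul_measure_le ν hT hdisj hN0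
  rw [hνuniv, hνapp _ (hT i)] at hi
  refine ⟨N, hN0, i, hiN, le_trans (mul_le_mul_right le_self_add _) hi, fun j hj => ?_⟩
  have hj' : (N : ℝ≥0∞) * (η / μ (B j) * μ (T i ∩ B j)) ≤ τ := by
    refine le_trans (mul_le_mul_right (le_trans ?_ le_add_self) _) hi
    exact Finset.single_le_sum (f := fun j => η / μ (B j) * μ (T i ∩ B j))
      (fun _ _ => zero_le) (Finset.mem_range.2 (Nat.lt_succ_of_le hj))
  have hNη0 : (N : ℝ≥0∞) * η ≠ 0 := mul_ne_zero (by exact_mod_cast hN0.ne') hη0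
  refine (ENNReal.mul_le_mul_iff_right hNη0 (ENNReal.mul_ne_top (by simp) hηtop)).1 ?_
  calc (N : ℝ≥0∞) * η * (4 * μ (T i ∩ B j))
      = 4 * (N * (η / μ (B j) * μ (B j) * μ (T i ∩ B j))) := by
        rw [ENNReal.div_mul_cancel (hB0 j) (hBtop j)]
        ring
    _ = 4 * (N * (η / μ (B j) * μ (T i ∩ B j))) * μ (B j) := by ring
    _ ≤ N * η * μ (B j) := by
        refine mul_le_mul_left ?_ _
        exact (mul_le_mul_right hj' 4).trans hNη

theorem MMS.exists_scale_le [BorelSpace X] {μ : Measure X} {Cd CP lam : ℝ}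
    (hM : MMS μ Cd CP lam) {x : X} {r : ℝ} (hr : 0 < r) {A : Set X} {J : ℕ}
    (hann : μ (ball x (4 * r)) ≤ ENNReal.ofReal Cd ^ 3 * μ (ball x (4 * r) \ ball x (2 * r)))
    (hJ : μ (ball x (4 * r / 2 ^ J)) ≤ 2 * μ (A ∩ ball x (4 * r / 2 ^ J)))
    {u : X → ℝ} (hu : AEStronglyMeasurable u μ) (huA : ∀ y ∈ A, 1 ≤ u y)
    (hu0 : ∀ y ∈ (ball x (2 * r))ᶜ, u y = 0) {g : X → ℝ≥0∞} (hgm : Measurable g)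
    (hg : IsUpperGradientOn g u univ) {τ : ℝ≥0∞} (hτ : τ ≠ ⊤) (hlt : ∫⁻ y, g y ∂μ < τ) :
    ∃ j ≤ J, μ (ball x (4 * r / 2 ^ j)) ≤
      4 * ENNReal.ofReal Cd ^ 3 * (2 * ENNReal.ofReal (CP * (4 * r / 2 ^ j)) * τ) := by
  set D := ENNReal.ofReal Cd with hDdef
  have hD : 1 ≤ D := ENNReal.one_le_ofReal.2 hM.hCd
  set ρ : ℕ → ℝ := fun j => 4 * r / 2 ^ j with hρ
  have hρ0 : ∀ j, 0 < ρ j := fun j => by positivity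
  have hρs : ∀ j, 2 * ρ (j + 1) = ρ j := fun j => by
    simp only [hρ, pow_succ]
    field_simp
  obtain ⟨N, hN, i, hiN, hiτ, hthin⟩ := exists_thin_layer (f := hu.mk u)
    hu.stronglyMeasurable_mk.measurable (B := fun j => ball x (ρ j))
    (fun j => hM.measure_ball_ne_zero x (hρ0 j))
    (fun j => hM.measure_ball_ne_top x (hρ0 j)) J hτ hlt
  have hNr : (0 : ℝ) < N := by exact_mod_cast hN
  set p : ℝ := i / N with hp
  set q : ℝ := (i + 1) / N with hq
  have hqp : q - p = 1 / N := by rw [hp, hq]; ring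
  have hpq : p ≤ q := by
    have : 0 < 1 / (N : ℝ) := by positivity
    linarith
  have hp0 : 0 ≤ p := by positivity
  have hq1 : q ≤ 1 := by
    rw [hq, div_le_one hNr]
    exact_mod_cast hiN
  set T := hu.mk u ⁻¹' Ioo p q with hT
  set Z := toMeasurable μ {y | u y ≠ hu.mk u y} with hZdef
  have hZ : μ Z = 0 := by
    rw [hZdef, measure_toMeasurable]
    exact hu.ae_eq_mk
  have hTZm : MeasurableSet (T ∪ Z) :=
    (hu.stronglyMeasurable_mk.measurable measurableSet_Ioo).union (measurableSet_toMeasurable _ _)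
  have hTZ : ∀ y, p < u y → u y < q → y ∈ T ∪ Z := by
    intro y h1 h2
    by_cases h : u y = hu.mk u y
    · exact Or.inl ⟨h ▸ h1, h ▸ h2⟩
    · exact Or.inr (subset_toMeasurable _ _ h)
  set v : X → ℝ := fun y => max p (min q (u y)) with hv
  have hvg : IsWeakUpperGradientOn μ ((T ∪ Z).indicator g) v univ :=
    hg.truncate hgm (hlt.trans_le le_top).ne hpq hTZ
  have hvm : AEStronglyMeasurable v μ :=
    (aemeasurable_const.max (aemeasurable_const.min hu.aemeasurable)).aestronglyMeasurable
  have hvloc : LocallyIntegrable v μ := hM.locallyIntegrable_of_bounded hvm (C := 1) fun y => by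
    rw [abs_of_nonneg (hp0.trans (le_max_left _ _))]
    exact max_le (hpq.trans hq1) ((min_le_left _ _).trans hq1)
  have hvint : ∫⁻ y, (T ∪ Z).indicator g y ∂μ ≤ ∫⁻ y in T, g y ∂μ := by
    rw [lintegral_indicator hTZm]
    refine (lintegral_union_le _ _ _).trans ?_
    rw [setLIntegral_measure_zero _ _ hZ, add_zero]
  set L := {y | v y ≤ p} with hL
  set H := {y | q ≤ v y} with hH
  have hcover : ∀ y, y ∈ L ∨ y ∈ H ∨ y ∈ T ∪ Z := by
    intro y
    rcases le_or_gt (u y) p with h | h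
    · exact Or.inl (max_le le_rfl ((min_le_right _ _).trans h))
    rcases le_or_gt q (u y) with h' | h'
    · exact Or.inr (Or.inl (le_max_of_le_right (le_min le_rfl h')))
    · exact Or.inr (Or.inr (hTZ y h h'))
  have hscale := exists_balanced_scale (b := fun j => μ (ball x (ρ j)))
    (l := fun j => μ (L ∩ ball x (ρ j))) (h := fun j => μ (H ∩ ball x (ρ j)))
    (s := fun j => μ (T ∩ ball x (ρ j))) hD (J := J)
    (fun j => hM.measure_ball_ne_top x (hρ0 j))
    (fun j _ => by
      have hsub : ball x (ρ j) ⊆ (L ∩ ball x (ρ j)) ∪ (H ∩ ball x (ρ j)) ∪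
          ((T ∩ ball x (ρ j)) ∪ Z) := by
        intro y hy
        rcases hcover y with h | h | h | h
        · exact Or.inl (Or.inl ⟨h, hy⟩)
        · exact Or.inl (Or.inr ⟨h, hy⟩)
        · exact Or.inr (Or.inl ⟨h, hy⟩)
        · exact Or.inr (Or.inr h)
      refine (measure_mono hsub).trans ((measure_union_le _ _).trans ?_)
      refine add_le_add (measure_union_le _ _) ((measure_union_le _ _).trans ?_)
      rw [hZ, add_zero])
    hthin
    (fun j => by
      refine measure_mono (inter_subset_inter_right _ (ball_subset_ball ?_))
      linarith [hρs j, hρ0 (j + 1)])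
    (fun j => by
      have := (hM.doubling x (ρ (j + 1)) (hρ0 _)).2.1
      rwa [hρs j] at this)
    (by
      have hρz : ρ 0 = 4 * r := by simp [hρ]
      simp only [hρz]
      refine hann.trans ?_
      gcongr
      intro y hy
      refine ⟨?_, hy.1⟩
      have : u y = 0 := hu0 y hy.2
      exact max_le le_rfl ((min_le_right _ _).trans (this.trans_le hp0)))
    (by
      refine hJ.trans ?_
      refine mul_le_mul' (le_mul_of_one_le_right' hD) (measure_mono ?_)
      refine inter_subset_inter_left _ fun y hy => ?_
      exact le_max_of_le_right (le_min le_rfl (hq1.trans (huA y hy))))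
  obtain ⟨j, hjJ, hjL, hjH⟩ := hscale
  refine ⟨j, hjJ, ?_⟩
  set m := min (μ (L ∩ ball x (ρ j))) (μ (H ∩ ball x (ρ j))) with hm
  have hbm : μ (ball x (ρ j)) ≤ 4 * D ^ 3 * m := by
    rcases min_choice (μ (L ∩ ball x (ρ j))) (μ (H ∩ ball x (ρ j))) with h | h
    · rwa [hm, h]
    · rwa [hm, h]
  refine hbm.trans (mul_le_mul_right ?_ _)
  have hjump := hM.jump_le x (hρ0 j) hvloc hvm (hgm.indicator hTZm) hvg (p := p) (q := q)
    (m := m) (min_le_left _ _) (min_le_right _ _)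
  have hNN : 2 * (N : ℝ≥0∞) * ENNReal.ofReal ((q - p) / 2) = 1 := by
    have h2 : 2 * (N : ℝ≥0∞) = ENNReal.ofReal (2 * N) := by
      rw [ENNReal.ofReal_mul zero_le_two]
      simp
    rw [h2, ← ENNReal.ofReal_mul (by positivity), hqp]
    have : 2 * (N : ℝ) * (1 / N / 2) = 1 := by field_simp
    rw [this, ENNReal.ofReal_one]
  calc m = 2 * N * (ENNReal.ofReal ((q - p) / 2) * m) := by rw [← mul_assoc, hNN, one_mul]
    _ ≤ 2 * N * (ENNReal.ofReal (CP * ρ j) * ∫⁻ y in T, g y ∂μ) := by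
        exact mul_le_mul_right (hjump.trans (mul_le_mul_right hvint _)) _
    _ = 2 * ENNReal.ofReal (CP * ρ j) * (N * ∫⁻ y in T, g y ∂μ) := by ring
    _ ≤ 2 * ENNReal.ofReal (CP * ρ j) * τ := by gcongr

theorem MMS.exists_density_scale {μ : Measure X} {Cd CP lam : ℝ} (hM : MMS μ Cd CP lam)
    {x : X} {A : Set X} (hx : x ∈ measInterior μ A) {R : ℝ} (hR : 0 < R) :
    ∃ J : ℕ, μ (ball x (R / 2 ^ J)) ≤ 2 * μ (A ∩ ball x (R / 2 ^ J)) := by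
  have hlim : Tendsto (fun n : ℕ => R / 2 ^ n) atTop (𝓝[>] 0) := by
    refine tendsto_nhdsWithin_iff.2 ⟨?_, Eventually.of_forall fun n => ?_⟩
    · have := (tendsto_pow_atTop_nhds_zero_of_lt_one (r := (1 / 2 : ℝ)) (by norm_num)
        (by norm_num)).const_mul R
      simpa [div_eq_mul_inv] using this
    · exact div_pos hR (by positivity)
  have hx' : Tendsto (fun r : ℝ => μ (ball x r \ A) / μ (ball x r)) (𝓝[>] 0) (𝓝 0) := hx
  obtain ⟨J, hJ⟩ := ((hx'.comp hlim).eventually_lt_const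
    (show (0 : ℝ≥0∞) < 2⁻¹ by simp)).exists
  refine ⟨J, ?_⟩
  have hpos : 0 < R / 2 ^ J := by positivity
  set b := μ (ball x (R / 2 ^ J)) with hb
  have hb0 : b ≠ 0 := hM.measure_ball_ne_zero x hpos
  have hbt : b ≠ ⊤ := hM.measure_ball_ne_top x hpos
  have h1 : μ (ball x (R / 2 ^ J) \ A) ≤ 2⁻¹ * b := (ENNReal.div_le_iff hb0 hbt).1 hJ.le
  have h2 : 2 * μ (ball x (R / 2 ^ J) \ A) ≤ b := by
    calc _ ≤ 2 * (2⁻¹ * b) := by gcongr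
      _ = b := by rw [← mul_assoc, ENNReal.mul_inv_cancel (by simp) (by simp), one_mul]
  have h3 : b ≤ μ (A ∩ ball x (R / 2 ^ J)) + μ (ball x (R / 2 ^ J) \ A) := by
    refine (measure_mono fun y hy => ?_).trans (measure_union_le _ _)
    by_cases h : y ∈ A
    · exact Or.inl ⟨h, hy⟩
    · exact Or.inr ⟨hy, h⟩
  refine (ENNReal.add_le_add_iff_left hbt).1 ?_
  calc b + b = 2 * b := (two_mul b).symm
    _ ≤ 2 * (μ (A ∩ ball x (R / 2 ^ J)) + μ (ball x (R / 2 ^ J) \ A)) := by gcongr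
    _ = 2 * μ (ball x (R / 2 ^ J) \ A) + 2 * μ (A ∩ ball x (R / 2 ^ J)) := by ring
    _ ≤ b + 2 * μ (A ∩ ball x (R / 2 ^ J)) := by gcongr

/-- **Capacity estimate.** If `0 < r < (1/8) diam X` and `A ⊆ B(x,r)` with `x ∈ I_A`, then
there exists `s ∈ (0,r]` such that `μ(B(x,s))/(C₂ s) ≤ cap₁(A, B(x,2r))`, where `C₂`
depends only on `C_d` and `C_P`. -/
theorem capacity_estimate_at_interior_points :
    ∀ (Cd CP : ℝ), ∃ C₂ : ℝ, 0 < C₂ ∧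
      ∀ (lam : ℝ) (X : Type*) [MetricSpace X] [MeasurableSpace X] [BorelSpace X]
        (μ : Measure X), MMS μ Cd CP lam →
        ∀ (x : X) (r : ℝ) (A : Set X), 0 < r →
          ENNReal.ofReal r < EMetric.diam (Set.univ : Set X) / 8 →
          A ⊆ Metric.ball x r → x ∈ measInterior μ A →
          ∃ s : ℝ, 0 < s ∧ s ≤ r ∧
            μ (Metric.ball x s) / ENNReal.ofReal (C₂ * s) ≤
              vcap1 μ A (Metric.ball x (2 * r)) := by
  intro Cd CP
  refine ⟨32 * max Cd 1 ^ 3 * max CP 1, by positivity, ?_⟩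
  intro lam X _ _ _ μ hM x r A hr hdiam _ hx
  have hann := hM.measure_ball_le_annulus x hr hdiam
  obtain ⟨J, hJ⟩ := hM.exists_density_scale hx (R := 4 * r) (by positivity)
  set C₂ := 32 * max Cd 1 ^ 3 * max CP 1 with hC₂
  have hC₂pos : 0 < C₂ := by positivity
  set f : ℕ → ℝ≥0∞ := fun j => μ (ball x (r / 2 ^ j)) / ENNReal.ofReal (C₂ * (r / 2 ^ j)) with hf
  obtain ⟨k, -, hk⟩ := (Finset.range (J + 1)).exists_min_image f ⟨0, by simp⟩
  have hfk : f k ≠ ⊤ := ENNReal.div_ne_top (hM.measure_ball_ne_top x (by positivity))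
    (ENNReal.ofReal_pos.2 (by positivity)).ne'
  refine ⟨r / 2 ^ k, by positivity, div_le_self hr.le (one_le_pow₀ one_le_two), ?_⟩
  change f k ≤ _
  by_contra! hlt
  simp only [vcap1, iInf_lt_iff] at hlt
  obtain ⟨u, hu, huA, hu0, g, hgm, hg, hglt⟩ := hlt
  obtain ⟨τ, hτg, hτf⟩ := exists_between hglt
  obtain ⟨δ, hδ0, hδ⟩ : ∃ δ : ℝ≥0∞, δ ≠ 0 ∧ ∫⁻ y, g y ∂μ + δ < τ := by
    obtain ⟨σ, hσg, hσ⟩ := exists_between hτg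
    refine ⟨σ - ∫⁻ y, g y ∂μ, (tsub_pos_of_lt hσg).ne', ?_⟩
    rwa [add_tsub_cancel_of_le hσg.le]
  obtain ⟨g', hg'm, hg', hle⟩ := hg.exists_isUpperGradientOn hgm hδ0
  obtain ⟨j, hjJ, hj⟩ := hM.exists_scale_le hr hann hJ hu.1.aestronglyMeasurable huA hu0 hg'm hg'
    (hτf.trans_le le_top).ne (hle.trans_lt hδ)
  refine absurd ((hk j (Finset.mem_range.2 (Nat.lt_succ_of_le hjJ))).trans ?_) (not_le.2 hτf)
  refine ENNReal.div_le_of_le_mul ?_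
  have hρ : r / 2 ^ j ≤ 4 * r / 2 ^ j := by
    gcongr
    linarith
  refine (measure_mono (ball_subset_ball hρ)).trans (hj.trans ?_)
  have h4 : (4 : ℝ≥0∞) = ENNReal.ofReal 4 := by norm_num
  have h2 : (2 : ℝ≥0∞) = ENNReal.ofReal 2 := by norm_num
  have hCd : 0 ≤ Cd := zero_le_one.trans hM.hCd
  have hCP := hM.hCP
  calc 4 * ENNReal.ofReal Cd ^ 3 * (2 * ENNReal.ofReal (CP * (4 * r / 2 ^ j)) * τ)
      = τ * (4 * ENNReal.ofReal Cd ^ 3 * (2 * ENNReal.ofReal (CP * (4 * r / 2 ^ j)))) := by ring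
    _ = τ * ENNReal.ofReal (4 * Cd ^ 3 * (2 * (CP * (4 * r / 2 ^ j)))) := by
        rw [h4, h2, ← ENNReal.ofReal_pow hCd, ← ENNReal.ofReal_mul (by norm_num),
          ← ENNReal.ofReal_mul (by norm_num), ← ENNReal.ofReal_mul (by positivity)]
    _ = τ * ENNReal.ofReal (32 * Cd ^ 3 * CP * (r / 2 ^ j)) := by
        congr 2
        ring
    _ ≤ τ * ENNReal.ofReal (C₂ * (r / 2 ^ j)) := by
        rw [hC₂]
        gcongr
        · exact le_max_left _ _
        · exact le_max_left _ _

end MetricBV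
end
end

section
/- Let f : (0,∞) → (0,∞) be a function with lim_{r→0+} f(r) = 0, and for every r > 0 pick a number s_r ∈ (0,r]. Then limsup_{r→0+} f(r)/f(s_r) ≥ 1. -/
open MeasureTheory Metric Filter Set
open scoped ENNReal NNReal Topology

noncomputable section

namespace MetricBV

variable {X : Type*} [MetricSpace X] [MeasurableSpace X]

/-- A function that is eventually bounded by `1` near `0⁺` and satisfies `f r ≤ c * f (s r)` there,
with `c` in `[0,1)` and `0 < s r ≤ r`, takes a nonpositive value at some positive point. -/
theorem exists_pos_apply_nonpos_of_eventually_le_mul {f s : ℝ → ℝ} {c : ℝ} (hc0 : 0 ≤ c)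
    (hc1 : c < 1) (hs : ∀ r : ℝ, 0 < r → 0 < s r ∧ s r ≤ r)
    (hbdd : ∀ᶠ r in 𝓝[>] (0 : ℝ), f r ≤ 1)
    (hle : ∀ᶠ r in 𝓝[>] (0 : ℝ), f r ≤ c * f (s r)) :
    ∃ r, 0 < r ∧ f r ≤ 0 := by
  obtain ⟨δ, hδ, hδs⟩ := mem_nhdsGT_iff_exists_Ioo_subset.1 (hbdd.and hle)
  have hpow : ∀ n : ℕ, ∀ r ∈ Ioo 0 δ, f r ≤ c ^ n := by
    intro n
    induction n with
    | zero => exact fun r hr => by simpa using (hδs hr).1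
    | succ n ih =>
      intro r hr
      obtain ⟨hs0, hsr⟩ := hs r hr.1
      calc f r ≤ c * f (s r) := (hδs hr).2
        _ ≤ c * c ^ n := mul_le_mul_of_nonneg_left (ih _ ⟨hs0, hsr.trans_lt hr.2⟩) hc0
        _ = c ^ (n + 1) := (pow_succ' c n).symm
  obtain ⟨r, hr⟩ := exists_between (mem_Ioi.1 hδ)
  exact ⟨r, hr.1, ge_of_tendsto' (tendsto_pow_atTop_nhds_zero_of_lt_one hc0 hc1)
    fun n => hpow n r hr⟩

/-- If `f : (0,∞) → (0,∞)` satisfies `f(r) → 0` as `r → 0⁺` and `s_r ∈ (0,r]` for every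
`r > 0`, then `limsup_{r→0⁺} f(r)/f(s_r) ≥ 1`. -/
theorem limsup_ratio_ge_one
    (f : ℝ → ℝ) (hf : ∀ r : ℝ, 0 < r → 0 < f r)
    (hlim : Filter.Tendsto f (𝓝[>] (0 : ℝ)) (𝓝 0))
    (s : ℝ → ℝ) (hs : ∀ r : ℝ, 0 < r → 0 < s r ∧ s r ≤ r) :
    1 ≤ Filter.limsup (fun r : ℝ => ENNReal.ofReal (f r / f (s r))) (𝓝[>] (0 : ℝ)) := by
  by_contra! h
  obtain ⟨c, hlc, hc1⟩ := ENNReal.lt_iff_exists_nnreal_btwn.1 h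
  have hle : ∀ᶠ r in 𝓝[>] (0 : ℝ), f r ≤ c * f (s r) := by
    filter_upwards [eventually_lt_of_limsup_lt hlc, self_mem_nhdsWithin] with r hr hr0
    have hr' : f r / f (s r) < c :=
      (ENNReal.ofReal_lt_coe_iff (div_pos (hf r hr0) (hf _ (hs r hr0).1)).le).1 hr
    exact ((div_lt_iff₀ (hf _ (hs r hr0).1)).1 hr').le
  obtain ⟨r, hr0, hr⟩ := exists_pos_apply_nonpos_of_eventually_le_mul c.coe_nonneg
    (by exact_mod_cast hc1) hs (hlim.eventually_le_const one_pos) hle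
  exact hr.not_gt (hf r hr0)

end MetricBV
end
end
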